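/- arXiv:1503.08090 — 2 statements merged into one kernel-verified Lean document; each statement's English description precedes it below -/
import Mathlib

section
/- If w : P → ℝ satisfies F♭(w)(p) ≤ w(p) for all p ∈ P, then R ⊆ w⋆, where R = ⋃_{k∈ℕ} G^k(X^in) is the reachable value set of the constrained piecewise polynomial system. -/
open MvPolynomial Filter

noncomputable section

abbrev MvPoly (d : ℕ) := MvPolynomial (Fin d) ℝ

/-- `q` is a sum of squares of polynomials (`q ∈ Σ[x]`). -/
def IsSOS {d : ℕ} (q : MvPoly d) : Prop :=
  ∃ (n : ℕ) (g : Fin n → MvPoly d), q = ∑ j, g j ^ 2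

/-- The map `ℝ^d → ℝ^d` whose components are the polynomials `T j`. -/
def polyMapApply {d : ℕ} (T : Fin d → MvPoly d) (x : Fin d → ℝ) : Fin d → ℝ :=
  fun j => eval x (T j)

/-- Degree of a polynomial map: the maximum total degree of its components. -/
def degMap {d : ℕ} (T : Fin d → MvPoly d) : ℕ :=
  Finset.univ.sup fun j => (T j).totalDegree

/-- `ur : P → ℝ` is the real-valued representative of `u : P → ℝ̄`. -/
def RealRep {ιP : Type} (u : ιP → EReal) (ur : ιP → ℝ) : Prop :=
  ∀ p, Real.toEReal (ur p) = u p

/-- Context: a constrained piecewise discrete-time polynomial system together with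
a finite basis of polynomial templates of degree at most `2m`. -/
structure PPSCtx (d m : ℕ) (I ιP : Type) [Fintype I] [Fintype ιP] where
  nI : I → ℕ
  rI : (i : I) → Fin (nI i) → MvPoly d
  n0 : ℕ
  r0 : Fin n0 → MvPoly d
  nin : ℕ
  rin : Fin nin → MvPoly d
  T : I → Fin d → MvPoly d
  tmpl : ιP → MvPoly d
  htmpl : ∀ p, (tmpl p).totalDegree ≤ 2 * m

namespace PPSCtx

variable {d m : ℕ} {I ιP : Type} [Fintype I] [Fintype ιP] (S : PPSCtx d m I ιP)

def Xi (i : I) : Set (Fin d → ℝ) := {x | ∀ j, eval x (S.rI i j) ≤ 0}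

def X0 : Set (Fin d → ℝ) := {x | ∀ k, eval x (S.r0 k) ≤ 0}

def Xin : Set (Fin d → ℝ) := {x | ∀ j, eval x (S.rin j) ≤ 0}

def wStar (w : ιP → ℝ) : Set (Fin d → ℝ) := {x | ∀ p, eval x (S.tmpl p) ≤ w p}

/-- `F♯_i(w)(p)`. -/
def FsharpI (w : ιP → ℝ) (i : I) (p : ιP) : EReal :=
  ⨆ x ∈ S.wStar w ∩ S.Xi i ∩ S.X0,
    Real.toEReal (eval (polyMapApply (S.T i) x) (S.tmpl p))

/-- `X^in†(p)`. -/
def XinDag (p : ιP) : EReal :=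
  ⨆ x ∈ S.Xin, Real.toEReal (eval x (S.tmpl p))

/-- The SOS certificate constraints witnessing the bound `η` in `F_i♭(w)(p)`. -/
def FibWitness (w : ιP → ℝ) (i : I) (p : ιP) (η : ℝ) (lam : ιP → ℝ)
    (σ : MvPoly d) (μ : Fin (S.nI i) → MvPoly d) (γ : Fin S.n0 → MvPoly d) : Prop :=
  (∀ q, 0 ≤ lam q) ∧ IsSOS σ ∧ (∀ l, IsSOS (μ l)) ∧ (∀ l, IsSOS (γ l)) ∧
  (C η - aeval (S.T i) (S.tmpl p) - (∑ q, C (lam q) * (C (w q) - S.tmpl q))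
      + (∑ l, μ l * S.rI i l) + (∑ l, γ l * S.r0 l) = σ) ∧
  σ.totalDegree ≤ 2 * m * degMap (S.T i) ∧
  ((∑ l, μ l * S.rI i l) + (∑ l, γ l * S.r0 l)).totalDegree ≤ 2 * m * degMap (S.T i)

/-- `F_i♭(w)(p)`. -/
def Fib (w : ιP → ℝ) (i : I) (p : ιP) : EReal :=
  sInf (Real.toEReal '' {η : ℝ | ∃ lam σ μ γ, S.FibWitness w i p η lam σ μ γ})

/-- `X^in♭(p)`. -/
def Xinb (p : ιP) : EReal :=
  sInf (Real.toEReal '' {η : ℝ | ∃ (σ₀ : MvPoly d) (ν : Fin S.nin → MvPoly d),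
    IsSOS σ₀ ∧ (∀ j, IsSOS (ν j)) ∧
    (C η - S.tmpl p + ∑ j, ν j * S.rin j = σ₀) ∧
    σ₀.totalDegree ≤ 2 * m ∧ (∑ j, ν j * S.rin j).totalDegree ≤ 2 * m})

/-- `F♭(w)(p)`. -/
def Fb (w : ιP → ℝ) (p : ιP) : EReal :=
  max (⨆ i, S.Fib w i p) (S.Xinb p)

/-- `Sol(w,i,p)`: feasible tuples attaining the infimum `F_i♭(w)(p)`. -/
def Sol (w : ιP → ℝ) (i : I) (p : ιP) (lam : ιP → ℝ)
    (σ : MvPoly d) (μ : Fin (S.nI i) → MvPoly d) (γ : Fin S.n0 → MvPoly d) : Prop :=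
  ∃ η : ℝ, S.FibWitness w i p η lam σ μ γ ∧ Real.toEReal η = S.Fib w i p

/-- `FS`: template bounds for which `Sol(w,i,p)` is nonempty for all `i`, `p`. -/
def FS (w : ιP → ℝ) : Prop :=
  ∀ (i : I) (p : ιP), ∃ lam σ μ γ, S.Sol w i p lam σ μ γ

/-- `lamP` is the `λ`-part of a policy choice `π(w)`. -/
def IsPolicy (w : ιP → ℝ) (lamP : I → ιP → ιP → ℝ) : Prop :=
  ∀ (i : I) (p : ιP), ∃ σ μ γ, S.Sol w i p (lamP i p) σ μ γ

/-- `φ_{w,i,p}^λ(v)` for `v : P → ℝ̄`. -/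
def phiE (w : ιP → ℝ) (lam : ιP → ℝ) (i : I) (p : ιP) (v : ιP → EReal) : EReal :=
  (∑ q, Real.toEReal (lam q) * v q) + S.Fib w i p - Real.toEReal (∑ q, lam q * w q)

/-- `Φ_w^{π(w)}(v)(p)`. -/
def PhiE (w : ιP → ℝ) (lamP : I → ιP → ιP → ℝ) (v : ιP → EReal) (p : ιP) : EReal :=
  max (⨆ i, S.phiE w (lamP i p) i p v) (S.Xinb p)

/-- The least fixpoint of `Φ_w^{π(w)}` on the complete lattice `P → ℝ̄`
(by the Knaster–Tarski theorem, the infimum of the post-fixpoints). -/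
def lfpPhi (w : ιP → ℝ) (lamP : I → ιP → ιP → ℝ) : ιP → EReal :=
  sInf {v : ιP → EReal | ∀ p, S.PhiE w lamP v p ≤ v p}

/-- The policy iteration sequence. -/
def IsPolicySeq (W : ℕ → ιP → EReal) : Prop :=
  (∃ w0 : ιP → ℝ, RealRep (W 0) w0 ∧ ∀ p, S.Fb w0 p ≤ Real.toEReal (w0 p)) ∧
  (∀ p, ∃ r : ℝ, S.Xinb p = Real.toEReal r) ∧
  (∀ k : ℕ,
    (∀ wr : ιP → ℝ, RealRep (W k) wr → S.FS wr →
      ∃ lamP, S.IsPolicy wr lamP ∧ W (k + 1) = S.lfpPhi wr lamP) ∧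
    ((¬ ∃ wr : ιP → ℝ, RealRep (W k) wr ∧ S.FS wr) → W (k + 1) = W k))

end PPSCtx

theorem IsSOS.eval_nonneg {d : ℕ} {q : MvPoly d} (hq : IsSOS q) (x : Fin d → ℝ) :
    0 ≤ eval x q := by
  obtain ⟨n, g, rfl⟩ := hq
  simp only [map_sum, map_pow]
  exact Finset.sum_nonneg fun j _ => sq_nonneg _

theorem eval_sum_mul_nonpos_of_isSOS {d n : ℕ} {μ r : Fin n → MvPoly d}
    (hμ : ∀ l, IsSOS (μ l)) {x : Fin d → ℝ} (hx : ∀ l, eval x (r l) ≤ 0) :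
    eval x (∑ l, μ l * r l) ≤ 0 := by
  simp only [map_sum, map_mul]
  exact Finset.sum_nonpos fun l _ =>
    mul_nonpos_of_nonneg_of_nonpos ((hμ l).eval_nonneg x) (hx l)

theorem eval_aeval_eq_eval_polyMapApply {d : ℕ} (T : Fin d → MvPoly d) (p : MvPoly d)
    (x : Fin d → ℝ) : eval x (aeval T p) = eval (polyMapApply T x) p := by
  induction p using MvPolynomial.induction_on with
  | C a => simp
  | add p q hp hq => simp only [map_add, hp, hq]
  | mul_X p j hp => simp only [map_mul, hp, aeval_X, eval_X, polyMapApply]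

namespace PPSCtx

variable {d m : ℕ} {I ιP : Type} [Fintype I] [Fintype ιP] (S : PPSCtx d m I ιP)

theorem eval_le_Fib {w : ιP → ℝ} {i : I} {x : Fin d → ℝ} (hw : x ∈ S.wStar w)
    (hi : x ∈ S.Xi i) (h0 : x ∈ S.X0) (p : ιP) :
    Real.toEReal (eval (polyMapApply (S.T i) x) (S.tmpl p)) ≤ S.Fib w i p := by
  refine le_sInf ?_
  rintro _ ⟨η, ⟨lam, σ, μ, γ, hlam, hσ, hμ, hγ, heq, -, -⟩, rfl⟩
  have hsum : 0 ≤ eval x (∑ q, C (lam q) * (C (w q) - S.tmpl q)) := by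
    simp only [map_sum, map_mul, map_sub, eval_C]
    exact Finset.sum_nonneg fun q _ => mul_nonneg (hlam q) (sub_nonneg.2 (hw q))
  have hμx := eval_sum_mul_nonpos_of_isSOS hμ hi
  have hγx := eval_sum_mul_nonpos_of_isSOS hγ h0
  have hσx := hσ.eval_nonneg x
  rw [← heq, map_add, map_add, map_sub, map_sub, eval_C,
    eval_aeval_eq_eval_polyMapApply] at hσx
  exact EReal.coe_le_coe_iff.2 (by linarith)

theorem eval_le_Xinb {x : Fin d → ℝ} (hx : x ∈ S.Xin) (p : ιP) :
    Real.toEReal (eval x (S.tmpl p)) ≤ S.Xinb p := by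
  refine le_sInf ?_
  rintro _ ⟨η, ⟨σ, ν, hσ, hν, heq, -, -⟩, rfl⟩
  have hνx := eval_sum_mul_nonpos_of_isSOS hν hx
  have hσx := hσ.eval_nonneg x
  rw [← heq, map_add, map_sub, eval_C] at hσx
  exact EReal.coe_le_coe_iff.2 (by linarith)

end PPSCtx

/-- over-approximation corollary: if `F♭(w) ≤ w` then the reachable
value set `R = ⋃ₖ Gᵏ(X^in)` is contained in `w⋆`. -/
theorem stmt9 {d m : ℕ} {I ιP : Type} [Fintype I] [Fintype ιP]
    (S : PPSCtx d m I ιP)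
    (hcover : ∀ x : Fin d → ℝ, ∃ i : I, x ∈ S.Xi i)
    (hdisj : ∀ i i' : I, i ≠ i' → S.Xi i ∩ S.Xi i' = ∅)
    (Tfun : (Fin d → ℝ) → (Fin d → ℝ))
    (hT : ∀ i : I, ∀ x ∈ S.Xi i, Tfun x = polyMapApply (S.T i) x)
    (w : ιP → ℝ) (hw : ∀ p, S.Fb w p ≤ Real.toEReal (w p)) :
    (⋃ k : ℕ, (fun s : Set (Fin d → ℝ) => Tfun '' (s ∩ S.X0))^[k] S.Xin) ⊆ S.wStar w := by
  refine Set.iUnion_subset fun k => ?_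
  induction k with
  | zero =>
    intro x hx p
    exact EReal.coe_le_coe_iff.1
      ((S.eval_le_Xinb hx p).trans ((le_max_right _ _).trans (hw p)))
  | succ k ih =>
    rw [Function.iterate_succ_apply']
    rintro _ ⟨x, ⟨hxk, hx0⟩, rfl⟩ p
    obtain ⟨i, hi⟩ := hcover x
    rw [hT i x hi]
    exact EReal.coe_le_coe_iff.1 ((S.eval_le_Fib (ih hxk) hi hx0 p).trans
      ((le_iSup (fun i => S.Fib w i p) i).trans ((le_max_left _ _).trans (hw p))))
end
end

section
/- The policy iteration sequence (w^k) is pointwise nonincreasing, i.e. w^{k+1}(p) ≤ w^k(p) for all k ∈ ℕ and p ∈ P, and for every p ∈ P the real sequence (w^k(p)) is bounded below by X^in♭(p) and converges in ℝ. -/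
open MvPolynomial Filter

noncomputable section

namespace PPSCtx

variable {d m : ℕ} {I ιP : Type} [Fintype I] [Fintype ιP] (S : PPSCtx d m I ιP)

theorem ereal_coe_sum {ι : Type} (s : Finset ι) (f : ι → ℝ) :
    ((∑ i ∈ s, f i : ℝ) : EReal) = ∑ i ∈ s, (f i : EReal) := by
  classical
  induction s using Finset.induction_on with
  | empty => simp
  | insert a s ha ih => rw [Finset.sum_insert ha, Finset.sum_insert ha, EReal.coe_add, ih]

theorem phiE_coe {w : ιP → ℝ} {lam : ιP → ℝ} {i : I} {p : ιP} {η : ℝ}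
    (hη : (η : EReal) = S.Fib w i p) (v : ιP → ℝ) :
    S.phiE w lam i p (fun q => (v q : EReal)) =
      ((∑ q, lam q * v q + η - ∑ q, lam q * w q : ℝ) : EReal) := by
  simp only [phiE, ← hη, EReal.coe_sub, EReal.coe_add, ereal_coe_sum, EReal.coe_mul]

theorem phiE_mono (w : ιP → ℝ) {lam : ιP → ℝ} (hlam : ∀ q, 0 ≤ lam q) (i : I) (p : ιP) :
    Monotone (S.phiE w lam i p) := by
  intro u v huv
  refine EReal.sub_le_sub (add_le_add (Finset.sum_le_sum fun q _ => ?_) le_rfl) le_rfl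
  exact mul_le_mul_of_nonneg_left (huv q) (EReal.coe_nonneg.2 (hlam q))

theorem PhiE_mono (w : ιP → ℝ) {lamP : I → ιP → ιP → ℝ} (hlam : ∀ i p q, 0 ≤ lamP i p q) :
    Monotone (S.PhiE w lamP) := fun _ _ huv p =>
  max_le_max (iSup_mono fun i => S.phiE_mono w (hlam i p) i p huv) le_rfl

theorem lfpPhi_le {w : ιP → ℝ} {lamP : I → ιP → ιP → ℝ} {v : ιP → EReal}
    (hv : ∀ p, S.PhiE w lamP v p ≤ v p) : S.lfpPhi w lamP ≤ v :=
  sInf_le hv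

theorem PhiE_lfpPhi_le (w : ιP → ℝ) {lamP : I → ιP → ιP → ℝ}
    (hlam : ∀ i p q, 0 ≤ lamP i p q) :
    S.PhiE w lamP (S.lfpPhi w lamP) ≤ S.lfpPhi w lamP :=
  le_sInf fun _ hv => (S.PhiE_mono w hlam (S.lfpPhi_le hv)).trans hv

/-- A certificate at `w` transfers to any `v`, shifting the certified bound by `∑ λ (v - w)`. -/
theorem FibWitness.shift {S : PPSCtx d m I ιP} {w : ιP → ℝ} {i : I} {p : ιP} {η : ℝ}
    {lam : ιP → ℝ} {σ : MvPoly d} {μ : Fin (S.nI i) → MvPoly d} {γ : Fin S.n0 → MvPoly d}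
    (h : S.FibWitness w i p η lam σ μ γ) (v : ιP → ℝ) :
    S.FibWitness v i p (∑ q, lam q * v q + η - ∑ q, lam q * w q) lam σ μ γ := by
  obtain ⟨h1, h2, h3, h4, h5, h6, h7⟩ := h
  refine ⟨h1, h2, h3, h4, ?_, h6, h7⟩
  rw [← h5]
  simp only [mul_sub, Finset.sum_sub_distrib, map_sub, map_add, map_sum, map_mul]
  ring

theorem Fib_le_phiE {w : ιP → ℝ} {i : I} {p : ιP} {lam : ιP → ℝ} {σ : MvPoly d}
    {μ : Fin (S.nI i) → MvPoly d} {γ : Fin S.n0 → MvPoly d}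
    (h : S.Sol w i p lam σ μ γ) (v : ιP → ℝ) :
    S.Fib v i p ≤ S.phiE w lam i p (fun q => (v q : EReal)) := by
  obtain ⟨η, hw, hη⟩ := h
  rw [S.phiE_coe hη]
  exact sInf_le ⟨_, ⟨lam, σ, μ, γ, hw.shift v⟩, rfl⟩

theorem phiE_self {w : ιP → ℝ} {i : I} {p : ιP} {lam : ιP → ℝ} {σ : MvPoly d}
    {μ : Fin (S.nI i) → MvPoly d} {γ : Fin S.n0 → MvPoly d}
    (h : S.Sol w i p lam σ μ γ) :
    S.phiE w lam i p (fun q => (w q : EReal)) = S.Fib w i p := by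
  obtain ⟨η, -, hη⟩ := h
  rw [S.phiE_coe hη, ← hη, add_sub_cancel_left]

/-- One improvement step from a real post-fixpoint of `F♭` gives a smaller real post-fixpoint. -/
theorem exists_real_lfpPhi (hX : ∀ p, ∃ r : ℝ, S.Xinb p = Real.toEReal r) {w : ιP → ℝ}
    (hw : ∀ p, S.Fb w p ≤ Real.toEReal (w p)) {lamP : I → ιP → ιP → ℝ}
    (hpol : S.IsPolicy w lamP) :
    ∃ v : ιP → ℝ, RealRep (S.lfpPhi w lamP) v ∧ (∀ p, S.Fb v p ≤ Real.toEReal (v p)) ∧ v ≤ w := by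
  have hlam : ∀ i p q, 0 ≤ lamP i p q := fun i p => by
    obtain ⟨_, _, _, _, hwit, _⟩ := hpol i p
    exact hwit.1
  have hle : S.lfpPhi w lamP ≤ fun q => (w q : EReal) := S.lfpPhi_le fun p => by
    refine le_trans (max_le_max (iSup_mono fun i => ?_) le_rfl) (hw p)
    obtain ⟨_, _, _, hsol⟩ := hpol i p
    exact (S.phiE_self hsol).le
  have hpost := S.PhiE_lfpPhi_le w hlam
  have hreal : ∀ p, ((S.lfpPhi w lamP p).toReal : EReal) = S.lfpPhi w lamP p := fun p => by
    refine EReal.coe_toReal (ne_top_of_le_ne_top (EReal.coe_ne_top _) (hle p)) ?_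
    obtain ⟨r, hr⟩ := hX p
    exact ne_bot_of_le_ne_bot (hr ▸ EReal.coe_ne_bot r) ((le_max_right _ _).trans (hpost p))
  refine ⟨fun p => (S.lfpPhi w lamP p).toReal, hreal, fun p => ?_, fun p => ?_⟩
  · rw [hreal p]
    refine le_trans (max_le_max (iSup_mono fun i => ?_) le_rfl) (hpost p)
    obtain ⟨_, _, _, hsol⟩ := hpol i p
    simpa only [hreal] using S.Fib_le_phiE hsol (fun p => (S.lfpPhi w lamP p).toReal)
  · rw [← EReal.coe_le_coe_iff, hreal p]
    exact hle p

theorem IsPolicySeq.exists_real_succ {S : PPSCtx d m I ιP} {W : ℕ → ιP → EReal}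
    (hseq : S.IsPolicySeq W) {k : ℕ} {w : ιP → ℝ} (hrep : RealRep (W k) w)
    (hw : ∀ p, S.Fb w p ≤ Real.toEReal (w p)) :
    ∃ v : ιP → ℝ, RealRep (W (k + 1)) v ∧ (∀ p, S.Fb v p ≤ Real.toEReal (v p)) ∧ v ≤ w := by
  obtain ⟨-, hX, hstep⟩ := hseq
  by_cases hFS : S.FS w
  · obtain ⟨lamP, hpol, heq⟩ := (hstep k).1 w hrep hFS
    rw [heq]
    exact S.exists_real_lfpPhi hX hw hpol
  · have heq := (hstep k).2 fun ⟨w', hrep', hFS'⟩ => hFS <| by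
      have : w' = w := funext fun p => EReal.coe_injective ((hrep' p).trans (hrep p).symm)
      exact this ▸ hFS'
    exact ⟨w, heq ▸ hrep, hw, le_rfl⟩

end PPSCtx

/-- part 2 of Theorem 1: the policy iteration sequence is real-valued,
pointwise nonincreasing, bounded below by `X^in♭`, and pointwise convergent in ℝ. -/
theorem stmt16 {d m : ℕ} {I ιP : Type} [Fintype I] [Fintype ιP]
    (S : PPSCtx d m I ιP) (W : ℕ → ιP → EReal) (hseq : S.IsPolicySeq W) :
    ∃ wr : ℕ → ιP → ℝ,
      (∀ k, RealRep (W k) (wr k)) ∧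
      (∀ k p, wr (k + 1) p ≤ wr k p) ∧
      (∀ k p, S.Xinb p ≤ Real.toEReal (wr k p)) ∧
      (∀ p, ∃ l : ℝ, Filter.Tendsto (fun k => wr k p) Filter.atTop (nhds l)) := by
  have hrep : ∀ k, ∃ w : ιP → ℝ, RealRep (W k) w ∧ ∀ p, S.Fb w p ≤ Real.toEReal (w p) := by
    intro k
    induction k with
    | zero => exact hseq.1
    | succ k ih =>
      obtain ⟨w, hrep, hw⟩ := ih
      obtain ⟨v, hv, hFb, -⟩ := hseq.exists_real_succ hrep hw
      exact ⟨v, hv, hFb⟩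
  choose wr hrep hFb using hrep
  have hstep : ∀ k p, wr (k + 1) p ≤ wr k p := fun k p => by
    obtain ⟨v, hv, -, hle⟩ := hseq.exists_real_succ (hrep k) (hFb k)
    have : wr (k + 1) p = v p := EReal.coe_injective ((hrep (k + 1) p).trans (hv p).symm)
    exact this ▸ hle p
  have hbound : ∀ k p, S.Xinb p ≤ Real.toEReal (wr k p) := fun k p =>
    (le_max_right _ _).trans (hFb k p)
  refine ⟨wr, hrep, hstep, hbound, fun p => ?_⟩
  obtain ⟨r, hr⟩ := hseq.2.1 p
  refine ⟨_, tendsto_atTop_ciInf (antitone_nat_of_succ_le fun k => hstep k p) ⟨r, ?_⟩⟩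
  rintro _ ⟨k, rfl⟩
  exact EReal.coe_le_coe_iff.1 (hr ▸ hbound k p)
end
end
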